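/- Let A ∈ ℝ^{m×n}, let k, b be positive integers, and suppose the following hold. (i) V ∈ ℝ^{n×(k+1)b} satisfies VᵀV = I. (ii) U_1, …, U_{k+1} ∈ ℝ^{m×b}, with U_{(k)} = [U_1, …, U_k] ∈ ℝ^{m×kb} their horizontal concatenation, and ε ≥ 0 satisfies ‖U_iᵀU_i − I‖₂ ≤ ε for all 1 ≤ i ≤ k+1 and ‖U_{i−1}ᵀU_i‖₂ ≤ ε for all 2 ≤ i ≤ k+1. (iii) B ∈ ℝ^{kb×(k+1)b} is block upper bidiagonal with b×b blocks: its (i,i) block is R_i for 1 ≤ i ≤ k, its (i,i+1) block is L_{i+1} for 1 ≤ i ≤ k, and all other blocks are zero. (iv) R_{k+1} ∈ ℝ^{b×b}, D ∈ ℝ^{m×(k+1)b}, δ ≥ 0, and d ≥ 0 satisfy A·V = U_{(k)}B + C + D, where C ∈ ℝ^{m×(k+1)b} is zero in its first kb columns and equals U_{k+1}R_{k+1} in its last b columns, and ‖D‖_F ≤ δ√d. (v) ‖B‖_F ≤ ‖A‖_F and ‖R_{k+1}‖_F · ‖L_{k+1}‖_F ≤ ‖A‖_F². Let E = ‖A‖_F²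 − ‖B‖_F². Then ‖A − U_{(k)} B Vᵀ‖_F² ≤ E + 4ε‖A‖_F² + 2δ√d(1 + 2ε)‖A‖_F. -/

import Mathlib

open Matrix

/-- The spectral norm (operator norm induced by the Euclidean vector norm) of a real matrix. -/
noncomputable def specNorm {α β : Type*} [Fintype α] [Fintype β] [DecidableEq α] [DecidableEq β]
    (M : Matrix α β ℝ) : ℝ :=
  ‖(Matrix.toEuclideanLin M).toContinuousLinearMap‖

/-- The squared Frobenius norm of a real matrix. -/
def frobSq {α β : Type*} [Fintype α] [Fintype β] (M : Matrix α β ℝ) : ℝ :=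
  ∑ i, ∑ j, (M i j) ^ 2

/-- The Frobenius norm of a real matrix. -/
noncomputable def frobNorm {α β : Type*} [Fintype α] [Fintype β] (M : Matrix α β ℝ) : ℝ :=
  Real.sqrt (frobSq M)

theorem abs_dotProduct_mulVec_le {α β : Type*} [Fintype α] [Fintype β] [DecidableEq α]
    [DecidableEq β] (M : Matrix α β ℝ) (x : α → ℝ) (y : β → ℝ) :
    |x ⬝ᵥ M *ᵥ y| ≤ specNorm M * (‖WithLp.toLp 2 x‖ * ‖WithLp.toLp 2 y‖) := by
  have h : x ⬝ᵥ M *ᵥ y = inner ℝ (WithLp.toLp 2 x)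
      ((Matrix.toEuclideanLin M).toContinuousLinearMap (WithLp.toLp 2 y)) := by
    simp [EuclideanSpace.inner_eq_star_dotProduct, dotProduct_comm]
  rw [h]
  calc _ ≤ ‖WithLp.toLp 2 x‖ * ‖(Matrix.toEuclideanLin M).toContinuousLinearMap
          (WithLp.toLp 2 y)‖ := abs_real_inner_le_norm _ _
    _ ≤ ‖WithLp.toLp 2 x‖ * (specNorm M * ‖WithLp.toLp 2 y‖) := by
      gcongr
      exact ContinuousLinearMap.le_opNorm _ _
    _ = _ := by ring

theorem norm_toLp_sq {α : Type*} [Fintype α] (x : α → ℝ) :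
    ‖WithLp.toLp 2 x‖ ^ 2 = x ⬝ᵥ x := by
  rw [EuclideanSpace.norm_sq_eq]
  simp [dotProduct, sq]

theorem frobSq_nonneg {α β : Type*} [Fintype α] [Fintype β] (M : Matrix α β ℝ) :
    0 ≤ frobSq M := by
  unfold frobSq; positivity

theorem frobNorm_nonneg {α β : Type*} [Fintype α] [Fintype β] (M : Matrix α β ℝ) :
    0 ≤ frobNorm M := Real.sqrt_nonneg _

theorem frobNorm_sq {α β : Type*} [Fintype α] [Fintype β] (M : Matrix α β ℝ) :
    frobNorm M ^ 2 = frobSq M := Real.sq_sqrt (frobSq_nonneg M)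

theorem frobSq_eq_sum_col {α β : Type*} [Fintype α] [Fintype β] (M : Matrix α β ℝ) :
    frobSq M = ∑ j, M.col j ⬝ᵥ M.col j := by
  rw [frobSq, Finset.sum_comm]
  simp [dotProduct, sq]

theorem frobSq_eq_trace {α β : Type*} [Fintype α] [Fintype β] (M : Matrix α β ℝ) :
    frobSq M = (Mᵀ * M).trace := by
  rw [frobSq, Finset.sum_comm]
  simp [trace, mul_apply, sq]

theorem abs_trace_transpose_mul_le {α β : Type*} [Fintype α] [Fintype β]
    (M N : Matrix α β ℝ) : |(Mᵀ * N).trace| ≤ frobNorm M * frobNorm N := by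
  have key : ∀ M : Matrix α β ℝ, (Mᵀ * N).trace ≤ frobNorm M * frobNorm N := fun M => by
    have := Real.sum_mul_le_sqrt_mul_sqrt Finset.univ
      (fun p : β × α => M p.2 p.1) (fun p => N p.2 p.1)
    simp only [Fintype.sum_prod_type] at this
    rw [Finset.sum_comm (f := fun x y => M y x ^ 2),
      Finset.sum_comm (f := fun x y => N y x ^ 2)] at this
    simpa [trace, mul_apply, frobNorm, frobSq] using this
  refine abs_le'.2 ⟨key M, ?_⟩
  simpa [frobNorm, frobSq] using key (-M)

theorem abs_trace_transpose_mul_mul_le {α β γ : Type*} [Fintype α] [Fintype β] [Fintype γ]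
    [DecidableEq α] [DecidableEq β]
    (M : Matrix α β ℝ) (X : Matrix α γ ℝ) (Y : Matrix β γ ℝ) :
    |(Xᵀ * (M * Y)).trace| ≤ specNorm M * (frobNorm X * frobNorm Y) := by
  have h : (Xᵀ * (M * Y)).trace = ∑ c, X.col c ⬝ᵥ M *ᵥ Y.col c := by
    simp [trace, mul_apply, dotProduct, mulVec]
  rw [h]
  calc _ ≤ ∑ c, |X.col c ⬝ᵥ M *ᵥ Y.col c| := Finset.abs_sum_le_sum_abs _ _
    _ ≤ ∑ c, specNorm M * (‖WithLp.toLp 2 (X.col c)‖ * ‖WithLp.toLp 2 (Y.col c)‖) :=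
      Finset.sum_le_sum fun c _ => abs_dotProduct_mulVec_le _ _ _
    _ = specNorm M * ∑ c, ‖WithLp.toLp 2 (X.col c)‖ * ‖WithLp.toLp 2 (Y.col c)‖ := by
      rw [Finset.mul_sum]
    _ ≤ _ := by
      refine mul_le_mul_of_nonneg_left ?_ (norm_nonneg _)
      refine (Real.sum_mul_le_sqrt_mul_sqrt _ _ _).trans_eq ?_
      simp_rw [norm_toLp_sq, frobNorm, frobSq_eq_sum_col]

theorem frobSq_sub_mul_transpose {α β γ : Type*} [Fintype α] [Fintype β] [Fintype γ]
    [DecidableEq γ] (A : Matrix α β ℝ) (V : Matrix β γ ℝ) (hV : Vᵀ * V = 1)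
    (W : Matrix α γ ℝ) :
    frobSq (A - W * Vᵀ) = frobSq A - 2 * ((A * V)ᵀ * W).trace + frobSq W := by
  have h1 : (Aᵀ * (W * Vᵀ)).trace = ((A * V)ᵀ * W).trace := by
    rw [← Matrix.mul_assoc, trace_mul_comm, transpose_mul, Matrix.mul_assoc]
  have h2 : ((W * Vᵀ)ᵀ * A).trace = ((A * V)ᵀ * W).trace := by
    rw [← h1, ← trace_transpose, transpose_mul, transpose_transpose]
  have h3 : ((W * Vᵀ)ᵀ * (W * Vᵀ)).trace = (Wᵀ * W).trace := by
    rw [trace_mul_comm, transpose_mul, transpose_transpose, Matrix.mul_assoc,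
      ← Matrix.mul_assoc Vᵀ, hV, Matrix.one_mul, trace_mul_comm]
  simp only [frobSq_eq_trace, transpose_sub, Matrix.sub_mul, Matrix.mul_sub, trace_sub,
    h1, h2, h3]
  ring

/-- If the nonzero blocks of `v` sit on a set `S` over which the Gram matrix of the blocks `U i`
is blockwise `ε`-close to the identity, then `∑ i, U i *ᵥ v i` has nearly the norm of `v`. -/
theorem abs_dotProduct_sum_mulVec_sub_le {ι α β : Type*} [Fintype ι] [Fintype α] [Fintype β]
    [DecidableEq ι] [DecidableEq β] (U : ι → Matrix α β ℝ) (v : ι → β → ℝ)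
    (S : Finset ι) (hS : ∀ i ∉ S, v i = 0) {ε : ℝ}
    (hU : ∀ i ∈ S, ∀ l ∈ S, specNorm ((U i)ᵀ * U l - if i = l then 1 else 0) ≤ ε) :
    |(∑ i, U i *ᵥ v i) ⬝ᵥ (∑ i, U i *ᵥ v i) - ∑ i, v i ⬝ᵥ v i| ≤
      S.card * ε * ∑ i, v i ⬝ᵥ v i := by
  obtain rfl | ⟨i₀, hi₀⟩ := S.eq_empty_or_nonempty
  · have hv : ∀ i, v i = 0 := fun i => hS i (by simp)
    simp [hv]
  have hε : 0 ≤ ε := (norm_nonneg _).trans (hU i₀ hi₀ i₀ hi₀)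
  have e1 : ∑ i, U i *ᵥ v i = ∑ i ∈ S, U i *ᵥ v i :=
    (Finset.sum_subset S.subset_univ fun i _ hi => by simp [hS i hi]).symm
  have e2 : ∑ i, v i ⬝ᵥ v i = ∑ i ∈ S, v i ⬝ᵥ v i :=
    (Finset.sum_subset S.subset_univ fun i _ hi => by simp [hS i hi]).symm
  rw [e1, e2]
  have e3 : (∑ i ∈ S, U i *ᵥ v i) ⬝ᵥ (∑ i ∈ S, U i *ᵥ v i) - ∑ i ∈ S, v i ⬝ᵥ v i =
      ∑ i ∈ S, ∑ l ∈ S, v i ⬝ᵥ ((U i)ᵀ * U l - if i = l then 1 else 0) *ᵥ v l := by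
    rw [sum_dotProduct, ← Finset.sum_sub_distrib]
    refine Finset.sum_congr rfl fun i hi => ?_
    simp only [sub_mulVec, dotProduct_sub, Finset.sum_sub_distrib, dotProduct_sum]
    congr 1
    · refine Finset.sum_congr rfl fun l _ => ?_
      rw [← mulVec_mulVec, dotProduct_mulVec (v i), vecMul_transpose]
    · rw [Finset.sum_eq_single_of_mem i hi]
      · simp
      · intro l _ hl
        simp [hl.symm]
  rw [e3]
  calc _ ≤ ∑ i ∈ S, ∑ l ∈ S, |v i ⬝ᵥ ((U i)ᵀ * U l - if i = l then 1 else 0) *ᵥ v l| :=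
      (Finset.abs_sum_le_sum_abs _ _).trans
        (Finset.sum_le_sum fun i _ => Finset.abs_sum_le_sum_abs _ _)
    _ ≤ ∑ i ∈ S, ∑ l ∈ S, ε * (‖WithLp.toLp 2 (v i)‖ * ‖WithLp.toLp 2 (v l)‖) := by
      refine Finset.sum_le_sum fun i hi => Finset.sum_le_sum fun l hl => ?_
      refine (abs_dotProduct_mulVec_le _ _ _).trans ?_
      exact mul_le_mul_of_nonneg_right (hU i hi l hl) (by positivity)
    _ = ε * (∑ i ∈ S, ‖WithLp.toLp 2 (v i)‖) ^ 2 := by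
      rw [sq, Finset.sum_mul_sum, Finset.mul_sum]
      simp_rw [Finset.mul_sum]
    _ ≤ ε * (S.card * ∑ i ∈ S, ‖WithLp.toLp 2 (v i)‖ ^ 2) :=
      mul_le_mul_of_nonneg_left sq_sum_le_card_mul_sum_sq hε
    _ = _ := by
      simp_rw [norm_toLp_sq]
      ring

theorem specNorm_transpose {α β : Type*} [Fintype α] [Fintype β] [DecidableEq α]
    [DecidableEq β] (M : Matrix α β ℝ) : specNorm Mᵀ = specNorm M := by
  rw [← conjTranspose_eq_transpose_of_trivial]
  exact l2_opNorm_conjTranspose M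

/-- Left multiplication by locally nearly orthonormal blocks nearly preserves the Frobenius norm
of a block upper bidiagonal matrix. -/
theorem abs_frobSq_mul_sub_le {m k b : ℕ} (U : Fin (k + 1) → Matrix (Fin m) (Fin b) ℝ)
    (Ucat : Matrix (Fin m) (Fin k × Fin b) ℝ)
    (hUcat : ∀ (r : Fin m) (p : Fin k × Fin b), Ucat r p = U p.1.castSucc r p.2)
    {ε : ℝ} (hε : 0 ≤ ε)
    (hUdiag : ∀ i : Fin (k + 1), specNorm ((U i)ᵀ * U i - 1) ≤ ε)
    (hUadj : ∀ i j : Fin (k + 1), (j : ℕ) = (i : ℕ) + 1 → specNorm ((U i)ᵀ * U j) ≤ ε)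
    (B : Matrix (Fin k × Fin b) (Fin (k + 1) × Fin b) ℝ)
    (hB : ∀ (i : Fin k) (j : Fin (k + 1)) (r c : Fin b),
      (j : ℕ) ≠ i → (j : ℕ) ≠ (i : ℕ) + 1 → B (i, r) (j, c) = 0) :
    |frobSq (Ucat * B) - frobSq B| ≤ 2 * ε * frobSq B := by
  have hcol : ∀ q, |(Ucat * B).col q ⬝ᵥ (Ucat * B).col q - B.col q ⬝ᵥ B.col q| ≤
      2 * ε * (B.col q ⬝ᵥ B.col q) := by
    rintro ⟨j, c⟩
    let v : Fin k → Fin b → ℝ := fun i s => B (i, s) (j, c)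
    let S : Finset (Fin k) := {i | (j : ℕ) = i ∨ (j : ℕ) = (i : ℕ) + 1}
    have hS : S.card ≤ 2 := by
      have : S.map Fin.valEmbedding ⊆ {(j : ℕ), (j : ℕ) - 1} := by
        intro x hx
        simp only [S, Finset.mem_map, Finset.mem_filter, Finset.mem_univ, true_and,
          Fin.valEmbedding_apply] at hx
        obtain ⟨i, hi, rfl⟩ := hx
        simp only [Finset.mem_insert, Finset.mem_singleton]
        omega
      rw [← Finset.card_map Fin.valEmbedding]
      exact (Finset.card_le_card this).trans Finset.card_le_two
    have key := abs_dotProduct_sum_mulVec_sub_le (fun i : Fin k => U i.castSucc) v S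
      (fun i hi => by
        simp only [S, Finset.mem_filter, Finset.mem_univ, true_and, not_or] at hi
        funext s
        exact hB i j s c hi.1 hi.2) (ε := ε) (by
        intro i hi l hl
        simp only [S, Finset.mem_filter, Finset.mem_univ, true_and] at hi hl
        by_cases h : i = l
        · subst h
          simpa using hUdiag i.castSucc
        · have h' : (i : ℕ) ≠ l := fun h' => h (Fin.ext h')
          simp only [h, if_false, sub_zero]
          rcases Nat.lt_or_gt_of_ne h' with h' | h'
          · exact hUadj _ _ (by simp only [Fin.val_castSucc]; omega)
          · rw [← specNorm_transpose, transpose_mul, transpose_transpose]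
            exact hUadj _ _ (by simp only [Fin.val_castSucc]; omega))
    have e1 : (Ucat * B).col (j, c) = ∑ i : Fin k, U i.castSucc *ᵥ v i := by
      funext r
      simp [col_apply, mul_apply, Fintype.sum_prod_type, hUcat, mulVec, dotProduct, v]
    have e2 : B.col (j, c) ⬝ᵥ B.col (j, c) = ∑ i, v i ⬝ᵥ v i := by
      simp [dotProduct, Fintype.sum_prod_type, v]
    rw [e1, e2]
    refine key.trans ?_
    have h0 : 0 ≤ ∑ i, v i ⬝ᵥ v i := by simp_rw [← norm_toLp_sq]; positivity
    have : (S.card : ℝ) ≤ 2 := by exact_mod_cast hS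
    gcongr
  rw [frobSq_eq_sum_col, frobSq_eq_sum_col B, ← Finset.sum_sub_distrib, Finset.mul_sum]
  exact (Finset.abs_sum_le_sum_abs _ _).trans (Finset.sum_le_sum fun q _ => hcol q)

/-- accuracy of the error indicator, Theorem 3.3 of the paper.
Block rows of `B` are indexed by `Fin k × Fin b` and block columns by `Fin (k+1) × Fin b`.
The blocks `U i` for `i : Fin (k+1)` are `U_1, …, U_{k+1}` (0-based indexing), `Ucat` is the
horizontal concatenation `U₍k₎ = [U_1, …, U_k]`, `ε` bounds the local loss of orthogonality of
`U_1, …, U_{k+1}`, `R i` is `R_{i+1}`, `L i` is `L_{i+2}` (so `L ⟨k-1,_⟩` is `L_{k+1}`),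
`Rlast` is `R_{k+1}`, `C` is zero except its last block column which is `U_{k+1} R_{k+1}`,
and `A V₍k₊₁₎ = U₍k₎ B + C + D` with `‖D‖_F ≤ δ√d`.  Under `‖B‖_F ≤ ‖A‖_F` and
`‖R_{k+1}‖_F ‖L_{k+1}‖_F ≤ ‖A‖_F²`, with `E = ‖A‖_F² − ‖B‖_F²` one has
`‖A − U₍k₎ B V₍k₊₁₎ᵀ‖_F² ≤ E + 4ε‖A‖_F² + 2δ√d(1+2ε)‖A‖_F`. -/
theorem errorEstimate_accuracy (m n k b : ℕ) (hk : 0 < k) (hb : 0 < b)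
    (A : Matrix (Fin m) (Fin n) ℝ)
    (V : Matrix (Fin n) (Fin (k + 1) × Fin b) ℝ)
    (hV : Vᵀ * V = 1)
    (U : Fin (k + 1) → Matrix (Fin m) (Fin b) ℝ)
    (Ucat : Matrix (Fin m) (Fin k × Fin b) ℝ)
    (hUcat : ∀ (r : Fin m) (p : Fin k × Fin b), Ucat r p = U p.1.castSucc r p.2)
    (ε : ℝ) (hε : 0 ≤ ε)
    (hUdiag : ∀ i : Fin (k + 1), specNorm ((U i)ᵀ * U i - 1) ≤ ε)
    (hUadj : ∀ i j : Fin (k + 1), (j : ℕ) = (i : ℕ) + 1 → specNorm ((U i)ᵀ * U j) ≤ ε)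
    (R : Fin k → Matrix (Fin b) (Fin b) ℝ)
    (L : Fin k → Matrix (Fin b) (Fin b) ℝ)
    (B : Matrix (Fin k × Fin b) (Fin (k + 1) × Fin b) ℝ)
    (hB : ∀ (i : Fin k) (j : Fin (k + 1)) (r c : Fin b),
      B (i, r) (j, c) =
        if (j : ℕ) = (i : ℕ) then R i r c
        else if (j : ℕ) = (i : ℕ) + 1 then L i r c
        else 0)
    (Rlast : Matrix (Fin b) (Fin b) ℝ)
    (C D : Matrix (Fin m) (Fin (k + 1) × Fin b) ℝ)
    (hC : ∀ (r : Fin m) (j : Fin (k + 1)) (c : Fin b),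
      C r (j, c) = if (j : ℕ) = k then (U (Fin.last k) * Rlast) r c else 0)
    (δ : ℝ) (hδ : 0 ≤ δ) (d : ℕ)
    (hD : frobNorm D ≤ δ * Real.sqrt d)
    (hAV : A * V = Ucat * B + C + D)
    (hBA : frobNorm B ≤ frobNorm A)
    (hRL : frobNorm Rlast * frobNorm (L ⟨k - 1, by omega⟩) ≤ frobSq A)
    (E : ℝ) (hE : E = frobSq A - frobSq B) :
    frobSq (A - Ucat * B * Vᵀ) ≤
      E + 4 * ε * frobSq A + 2 * δ * Real.sqrt d * (1 + 2 * ε) * frobNorm A := by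
  have hW := abs_le.1 (abs_frobSq_mul_sub_le U Ucat hUcat hε hUdiag hUadj B
    fun i j r c h1 h2 => by simp [hB, h1, h2])
  have hBA' : frobSq B ≤ frobSq A := by
    rw [← frobNorm_sq, ← frobNorm_sq]
    exact pow_le_pow_left₀ (frobNorm_nonneg B) hBA 2
  let i₀ : Fin k := ⟨k - 1, by omega⟩
  have hCW : (Cᵀ * (Ucat * B)).trace =
      (Rlastᵀ * (((U (Fin.last k))ᵀ * U i₀.castSucc) * L i₀)).trace := by
    have hWlast : ∀ r c, (Ucat * B) r (Fin.last k, c) = (U i₀.castSucc * L i₀) r c := by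
      intro r c
      rw [mul_apply, mul_apply, Fintype.sum_prod_type, Finset.sum_eq_single i₀]
      · refine Finset.sum_congr rfl fun s _ => ?_
        rw [hUcat, hB, if_neg (by simp [i₀]; omega), if_pos (by simp [i₀]; omega)]
      · intro i _ hi
        refine Finset.sum_eq_zero fun s _ => ?_
        have hi' : (i : ℕ) ≠ k - 1 := fun h => hi (Fin.ext h)
        rw [hB, if_neg (by simp; omega), if_neg (by simp; omega), mul_zero]
      · simp
    have e : Rlastᵀ * (((U (Fin.last k))ᵀ * U i₀.castSucc) * L i₀) =
        (U (Fin.last k) * Rlast)ᵀ * (U i₀.castSucc * L i₀) := by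
      simp only [transpose_mul, Matrix.mul_assoc]
    rw [e]
    simp only [trace, diag_apply, mul_apply (M := Cᵀ),
      mul_apply (M := (U (Fin.last k) * Rlast)ᵀ), transpose_apply, Fintype.sum_prod_type]
    rw [Finset.sum_eq_single (Fin.last k)]
    · simp [hC, hWlast]
    · intro j _ hj
      have hj' : (j : ℕ) ≠ k := fun h => hj (Fin.ext h)
      simp [hC, hj']
    · simp
  have hCb : |(Cᵀ * (Ucat * B)).trace| ≤ ε * frobSq A := by
    rw [hCW]
    refine (abs_trace_transpose_mul_mul_le _ _ _).trans (mul_le_mul ?_ hRL ?_ hε)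
    · rw [← specNorm_transpose, transpose_mul, transpose_transpose]
      exact hUadj _ _ (by simp [i₀]; omega)
    · exact mul_nonneg (frobNorm_nonneg _) (frobNorm_nonneg _)
  have hWn : frobNorm (Ucat * B) ≤ (1 + 2 * ε) * frobNorm A := by
    have hA := frobNorm_nonneg A
    refine le_of_sq_le_sq ?_ (by positivity)
    rw [mul_pow, frobNorm_sq, frobNorm_sq]
    nlinarith [mul_nonneg hε (frobSq_nonneg A), mul_nonneg hε (sub_nonneg.2 hBA'),
      mul_nonneg hε (mul_nonneg hε (frobSq_nonneg A))]
  have hDb : |(Dᵀ * (Ucat * B)).trace| ≤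
      (δ * Real.sqrt d) * ((1 + 2 * ε) * frobNorm A) :=
    (abs_trace_transpose_mul_le _ _).trans
      (mul_le_mul hD hWn (frobNorm_nonneg _) (by positivity))
  rw [frobSq_sub_mul_transpose A V hV, hAV]
  simp only [transpose_add, Matrix.add_mul, trace_add, ← frobSq_eq_trace]
  have h1 := (abs_le.1 hCb).1
  have h2 := (abs_le.1 hDb).1
  have h3 := mul_le_mul_of_nonneg_left hBA' hε
  rw [hE]
  linarith [hW.1]
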